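/- arXiv:2304.09577 — 3 statements merged into one kernel-verified Lean document; each statement's English description precedes it below -/
import Mathlib

section
/- Let H be a real inner product space, Ω a set, φ : Ω → H a feature map, and x₀, …, x_{T−1} ∈ Ω data points. Define the kernel K(x,y) := ⟨φ(x), φ(y)⟩, the Gram matrix K_X ∈ ℝ^{T×T} with entries (K_X)_{ij} = K(x_i, x_j), and the vector k(x) ∈ ℝ^T with entries k(x)_i = K(x, x_i). Let λ > 0, let f ∈ H, let y ∈ ℝ^T have entries y_i = ⟨f, φ(x_i)⟩, and define the regularized interpolant s_f(x) := yᵀ (λI_T + K_X)^{-1} k(x) and the matrix K̂_X := (λI_T + K_X)(2λI_T + K_X)^{-1}(λI_T + K_X). Then for every x ∈ Ω, the interpolation error satisfies |⟨f, φ(x)⟩ − s_f(x)| ≤ ‖f‖ · √(K(x,x) − k(x)ᵀ K̂_X^{-1} k(x)). -/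
open scoped InnerProductSpace Matrix

theorem Matrix.PosSemidef.posDef_smul_one_add {n : Type*} [Fintype n] [DecidableEq n]
    {M : Matrix n n ℝ} (hM : M.PosSemidef) {c : ℝ} (hc : 0 < c) :
    (c • (1 : Matrix n n ℝ) + M).PosDef :=
  (Matrix.PosDef.one.smul hc).add_posSemidef hM

/-- With `A = c • 1 + M` and `u = A⁻¹ *ᵥ v`, the quadratic form of
`(A * (2 * c • 1 + M)⁻¹ * A)⁻¹` at `v` is expressed through `u`. -/
theorem Matrix.PosSemidef.dotProduct_inv_mulVec_regularized {n : Type*} [Fintype n]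
    [DecidableEq n] {M : Matrix n n ℝ} (hM : M.PosSemidef) {c : ℝ} (hc : 0 < c)
    {u v : n → ℝ} (huv : (c • (1 : Matrix n n ℝ) + M) *ᵥ u = v) :
    v ⬝ᵥ (((c • (1 : Matrix n n ℝ) + M) * ((2 * c) • (1 : Matrix n n ℝ) + M)⁻¹ *
      (c • (1 : Matrix n n ℝ) + M))⁻¹ *ᵥ v) = 2 * (u ⬝ᵥ v) - u ⬝ᵥ (M *ᵥ u) := by
  set A := c • (1 : Matrix n n ℝ) + M with hA
  have hApd : A.PosDef := hM.posDef_smul_one_add hc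
  have hBpd := hM.posDef_smul_one_add (c := 2 * c) (by positivity)
  have hAdet : IsUnit A.det := (Matrix.isUnit_iff_isUnit_det _).1 hApd.isUnit
  have hAT : Aᵀ = A := by simpa using hApd.isHermitian.eq
  have hu : A⁻¹ *ᵥ v = u := by
    rw [← huv, Matrix.mulVec_mulVec, Matrix.nonsing_inv_mul _ hAdet, Matrix.one_mulVec]
  have hu' : v ᵥ* A⁻¹ = u := by
    rw [← Matrix.mulVec_transpose, Matrix.transpose_nonsing_inv, hAT, hu]
  rw [Matrix.mul_inv_rev, Matrix.mul_inv_rev,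
    Matrix.nonsing_inv_nonsing_inv _ ((Matrix.isUnit_iff_isUnit_det _).1 hBpd.isUnit),
    ← Matrix.mulVec_mulVec, ← Matrix.mulVec_mulVec, hu, Matrix.dotProduct_mulVec, hu', ← huv, hA]
  simp only [Matrix.add_mulVec, Matrix.smul_mulVec, Matrix.one_mulVec, dotProduct_add,
    dotProduct_smul, smul_eq_mul]
  ring

/-- Deterministic error bound for regularized kernel interpolation
(Theorem 1 of the paper). -/
theorem kernel_interpolation_error_bound
    {H : Type*} [NormedAddCommGroup H] [InnerProductSpace ℝ H]
    {Ω : Type*} (φ : Ω → H) (T : ℕ) (xs : Fin T → Ω)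
    (K : Ω → Ω → ℝ) (hK : ∀ x y, K x y = ⟪φ x, φ y⟫_ℝ)
    (KX : Matrix (Fin T) (Fin T) ℝ) (hKX : ∀ i j, KX i j = K (xs i) (xs j))
    (k : Ω → Fin T → ℝ) (hk : ∀ x i, k x i = K x (xs i))
    (lam : ℝ) (hlam : 0 < lam)
    (f : H) (y : Fin T → ℝ) (hy : ∀ i, y i = ⟪f, φ (xs i)⟫_ℝ)
    (sf : Ω → ℝ)
    (hsf : ∀ x, sf x = y ⬝ᵥ ((lam • (1 : Matrix (Fin T) (Fin T) ℝ) + KX)⁻¹ *ᵥ k x))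
    (Khat : Matrix (Fin T) (Fin T) ℝ)
    (hKhat : Khat = (lam • (1 : Matrix (Fin T) (Fin T) ℝ) + KX) *
      ((2 * lam) • (1 : Matrix (Fin T) (Fin T) ℝ) + KX)⁻¹ *
      (lam • (1 : Matrix (Fin T) (Fin T) ℝ) + KX)) :
    ∀ x : Ω, |⟪f, φ x⟫_ℝ - sf x| ≤
      ‖f‖ * Real.sqrt (K x x - k x ⬝ᵥ (Khat⁻¹ *ᵥ k x)) := by
  intro x
  have hgram : KX = Matrix.gram ℝ (φ ∘ xs) := by
    ext i j
    simp [hKX, hK, Matrix.gram_apply]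
  have hpsd : KX.PosSemidef := hgram ▸ Matrix.posSemidef_gram ℝ (φ ∘ xs)
  set c := (lam • (1 : Matrix (Fin T) (Fin T) ℝ) + KX)⁻¹ *ᵥ k x with hc
  have hAc : (lam • (1 : Matrix (Fin T) (Fin T) ℝ) + KX) *ᵥ c = k x := by
    rw [hc, Matrix.mulVec_mulVec, Matrix.mul_nonsing_inv _
      ((Matrix.isUnit_iff_isUnit_det _).1 (hpsd.posDef_smul_one_add hlam).isUnit),
      Matrix.one_mulVec]
  set p := ∑ i, c i • φ (xs i) with hp
  have herr : ⟪f, φ x⟫_ℝ - sf x = ⟪f, φ x - p⟫_ℝ := by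
    rw [hsf, ← hc, inner_sub_right, hp, inner_sum]
    simp only [inner_smul_right, dotProduct, hy, mul_comm]
  have hxp : ⟪φ x, p⟫_ℝ = c ⬝ᵥ k x := by
    simp only [hp, inner_sum, inner_smul_right, dotProduct, hk, hK]
  have hpp : ‖p‖ ^ 2 = c ⬝ᵥ (KX *ᵥ c) := by
    rw [← real_inner_self_eq_norm_sq, hgram]
    simpa using (Matrix.star_dotProduct_gram_mulVec (φ ∘ xs) c c).symm
  have hnorm : K x x - k x ⬝ᵥ (Khat⁻¹ *ᵥ k x) = ‖φ x - p‖ ^ 2 := by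
    rw [hKhat, hpsd.dotProduct_inv_mulVec_regularized hlam hAc, norm_sub_sq_real, hxp, hpp, hK,
      real_inner_self_eq_norm_sq]
    ring
  rw [herr, hnorm, Real.sqrt_sq (norm_nonneg _)]
  exact abs_real_inner_le_norm _ _
end

section
/- Let F : ℝⁿ → ℝⁿ be the closed-loop state transition map, let V : ℝⁿ → ℝ be a candidate Lyapunov function, and let w : ℝⁿ → ℝ be an upper bound on the one-step Lyapunov difference, i.e., V(F(x)) − V(x) ≤ w(x) for all x ∈ ℝⁿ. Let γ > 0, define the sublevel set R_γ := {x : V(x) ≤ γ} and Z := {x : V(x) ≤ γ and w(x) > 0}. If V(x) + w(x) ≤ γ for every x ∈ Z, then R_γ is positively invariant for F: for every x ∈ ℝⁿ with V(x) ≤ γ and every t ∈ ℕ, the t-th iterate F^[t](x) satisfies V(F^[t](x)) ≤ γ. -/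
/-- Theorem 2 of the paper: if the Lyapunov difference along the closed-loop
map `F` is bounded by `w`, and `V x + w x ≤ γ` on the set `Z` of points of the
sublevel set where `w` is positive, then the sublevel set `{x : V x ≤ γ}` is
positively invariant for `F`. -/
theorem sublevel_set_positively_invariant
    (n : ℕ) (F : (Fin n → ℝ) → (Fin n → ℝ))
    (V w : (Fin n → ℝ) → ℝ)
    (hdiff : ∀ x, V (F x) - V x ≤ w x)
    (γ : ℝ) (hγ : 0 < γ)
    (hZ : ∀ x, V x ≤ γ → 0 < w x → V x + w x ≤ γ) :
    ∀ x, V x ≤ γ → ∀ t : ℕ, V (F^[t] x) ≤ γ := by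
  intro x hx t
  induction t with
  | zero => exact hx
  | succ t ih =>
    rw [Function.iterate_succ_apply']
    have hstep := hdiff (F^[t] x)
    rcases le_or_gt (w (F^[t] x)) 0 with hw | hw
    · linarith
    · linarith [hZ _ ih hw]
end

section
/- Let H be a real inner product space, Ω a set, φ : Ω → H a feature map, and x₀, …, x_{T−1} ∈ Ω data points. Define K(x,y) := ⟨φ(x), φ(y)⟩, the Gram matrix K_X ∈ ℝ^{T×T} with (K_X)_{ij} = K(x_i, x_j), the vector k(x) ∈ ℝ^T with k(x)_i = K(x, x_i), and, for λ > 0, the matrix K̂_X := (λI_T + K_X)(2λI_T + K_X)^{-1}(λI_T + K_X). Then for every x ∈ Ω, with u(x) := (λI_T + K_X)^{-1} k(x), the squared norm of the interpolation residual element satisfies ‖φ(x) − Σ_{i=0}^{T−1} u_i(x) φ(x_i)‖² = K(x,x) − k(x)ᵀ K̂_X^{-1} k(x). -/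
open scoped InnerProductSpace Matrix

open Matrix in
/-- Expansion of the squared distance from a vector to a linear combination, in terms of the
Gram matrix of the family. -/
theorem norm_sub_sum_smul_sq_eq_gram {H ι : Type*} [NormedAddCommGroup H] [InnerProductSpace ℝ H]
    [Fintype ι] (a : H) (v : ι → H) (u : ι → ℝ) :
    ‖a - ∑ i, u i • v i‖ ^ 2 =
      ⟪a, a⟫_ℝ - 2 * (u ⬝ᵥ fun i => ⟪a, v i⟫_ℝ) + u ⬝ᵥ (gram ℝ v *ᵥ u) := by
  have hquad := star_dotProduct_gram_mulVec (𝕜 := ℝ) v u u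
  rw [star_trivial] at hquad
  rw [hquad, norm_sub_sq_real, real_inner_self_eq_norm_sq, real_inner_self_eq_norm_sq, inner_sum]
  simp only [inner_smul_right, dotProduct]

/-- A positive semidefinite matrix shifted by a positive multiple of the identity is invertible. -/
theorem Matrix.PosSemidef.isUnit_det_smul_one_add {ι : Type*} [Fintype ι] [DecidableEq ι]
    {M : Matrix ι ι ℝ} (hM : M.PosSemidef) {c : ℝ} (hc : 0 < c) :
    IsUnit (c • (1 : Matrix ι ι ℝ) + M).det :=
  ((Matrix.isUnit_iff_isUnit_det _).1
    ((Matrix.PosDef.one.smul hc).add_posSemidef hM).isUnit)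

/-- The squared RKHS norm of the interpolation residual element equals the
regularized power function `K(x,x) − k(x)ᵀ K̂_X⁻¹ k(x)`. -/
theorem interpolation_residual_norm_sq
    {H : Type*} [NormedAddCommGroup H] [InnerProductSpace ℝ H]
    {Ω : Type*} (φ : Ω → H) (T : ℕ) (xs : Fin T → Ω)
    (K : Ω → Ω → ℝ) (hK : ∀ x y, K x y = ⟪φ x, φ y⟫_ℝ)
    (KX : Matrix (Fin T) (Fin T) ℝ) (hKX : ∀ i j, KX i j = K (xs i) (xs j))
    (k : Ω → Fin T → ℝ) (hk : ∀ x i, k x i = K x (xs i))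
    (lam : ℝ) (hlam : 0 < lam)
    (Khat : Matrix (Fin T) (Fin T) ℝ)
    (hKhat : Khat = (lam • (1 : Matrix (Fin T) (Fin T) ℝ) + KX) *
      ((2 * lam) • (1 : Matrix (Fin T) (Fin T) ℝ) + KX)⁻¹ *
      (lam • (1 : Matrix (Fin T) (Fin T) ℝ) + KX)) :
    ∀ x : Ω,
      ∀ u : Fin T → ℝ,
        u = (lam • (1 : Matrix (Fin T) (Fin T) ℝ) + KX)⁻¹ *ᵥ k x →
        ‖φ x - ∑ i : Fin T, u i • φ (xs i)‖ ^ 2 =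
          K x x - k x ⬝ᵥ (Khat⁻¹ *ᵥ k x) := by
  rintro x u rfl
  have hgram : KX = Matrix.gram ℝ (φ ∘ xs) := by
    ext i j
    rw [hKX, hK, Matrix.gram_apply, Function.comp_apply, Function.comp_apply]
  have hkx : k x = fun i => ⟪φ x, (φ ∘ xs) i⟫_ℝ := by
    ext i
    rw [hk, hK, Function.comp_apply]
  have hpsd : KX.PosSemidef := hgram ▸ Matrix.posSemidef_gram ℝ (φ ∘ xs)
  have hsymm : KXᵀ = KX := by simpa using hpsd.isHermitian.eq
  have hA := hpsd.isUnit_det_smul_one_add hlam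
  have hB := hpsd.isUnit_det_smul_one_add (mul_pos two_pos hlam)
  have hnorm := norm_sub_sum_smul_sq_eq_gram (φ x) (φ ∘ xs)
    ((lam • (1 : Matrix (Fin T) (Fin T) ℝ) + KX)⁻¹ *ᵥ k x)
  rw [← hgram, ← hkx, ← hK] at hnorm
  refine hnorm.trans ?_
  rw [hKhat, Matrix.mul_inv_rev, Matrix.mul_inv_rev, Matrix.nonsing_inv_nonsing_inv _ hB,
    ← Matrix.mulVec_mulVec, ← Matrix.mulVec_mulVec]
  obtain ⟨u, hu⟩ : ∃ u, u = (lam • (1 : Matrix (Fin T) (Fin T) ℝ) + KX)⁻¹ *ᵥ k x := ⟨_, rfl⟩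
  have hku : k x = (lam • (1 : Matrix (Fin T) (Fin T) ℝ) + KX) *ᵥ u := by
    rw [hu, Matrix.mulVec_mulVec, Matrix.mul_nonsing_inv _ hA, Matrix.one_mulVec]
  have hadj : ∀ w : Fin T → ℝ,
      k x ⬝ᵥ ((lam • (1 : Matrix (Fin T) (Fin T) ℝ) + KX)⁻¹ *ᵥ w) = u ⬝ᵥ w := by
    intro w
    rw [Matrix.dotProduct_mulVec, ← Matrix.mulVec_transpose, Matrix.transpose_nonsing_inv,
      Matrix.transpose_add, Matrix.transpose_smul, Matrix.transpose_one, hsymm, ← hu]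
  rw [hadj, ← hu, hku]
  simp only [Matrix.add_mulVec, Matrix.smul_mulVec, Matrix.one_mulVec, dotProduct_add,
    dotProduct_smul, smul_eq_mul]
  ring
end
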